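/- arXiv:1503.08571 — 4 statements merged into one kernel-verified Lean document; each statement's English description precedes it below -/
import Mathlib

section
/- One-sided topological Markov shifts (X_A, σ_A) and (X_B, σ_B) are one-sided flow equivalent if and only if they are continuously orbit equivalent. -/
open scoped BigOperators NNReal

namespace OneSidedMarkov

variable {N M : ℕ}

/-- The matrix has entries in `{0, 1}`. -/
def IsZeroOne (A : Matrix (Fin N) (Fin N) ℤ) : Prop := ∀ i j, A i j = 0 ∨ A i j = 1

/-- The matrix is irreducible. -/
def IsIrreducible (A : Matrix (Fin N) (Fin N) ℤ) : Prop :=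
  ∀ i j, ∃ m : ℕ, 0 < m ∧ (A ^ m) i j ≠ 0

/-- The matrix is a permutation matrix. -/
def IsPermutationMatrix (A : Matrix (Fin N) (Fin N) ℤ) : Prop :=
  ∃ e : Equiv.Perm (Fin N), ∀ i j, A i j = if e i = j then 1 else 0

/-- The one-sided topological Markov shift space `X_A`. -/
abbrev Space (A : Matrix (Fin N) (Fin N) ℤ) : Type :=
  {x : ℕ → Fin N // ∀ n, A (x n) (x (n + 1)) = 1}

/-- The shift map `σ_A`. -/
def shift (A : Matrix (Fin N) (Fin N) ℤ) (x : Space A) : Space A :=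
  ⟨fun n => x.1 (n + 1), fun n => x.2 (n + 1)⟩

lemma continuous_shift (A : Matrix (Fin N) (Fin N) ℤ) : Continuous (shift A) := by
  apply Continuous.subtype_mk
  exact continuous_pi fun n => (continuous_apply (n + 1)).comp continuous_subtype_val

/-- The shift map as a continuous map. -/
def shiftMap (A : Matrix (Fin N) (Fin N) ℤ) : C(Space A, Space A) :=
  ⟨shift A, continuous_shift A⟩

/-- The coboundary subgroup `{ g - g ∘ σ_A }` of `C(X_A, ℤ)`. -/
def cobdySubgroup (A : Matrix (Fin N) (Fin N) ℤ) : AddSubgroup C(Space A, ℤ) :=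
  AddSubgroup.closure {f | ∃ g : C(Space A, ℤ), f = g - g.comp (shiftMap A)}

/-- The ordered cohomology group `H^A = C(X_A, ℤ)/{g - g∘σ_A}`. -/
abbrev Coh (A : Matrix (Fin N) (Fin N) ℤ) : Type :=
  C(Space A, ℤ) ⧸ cobdySubgroup A

/-- The class `[f] ∈ H^A`. -/
def cohClass (A : Matrix (Fin N) (Fin N) ℤ) (f : C(Space A, ℤ)) : Coh A :=
  QuotientAddGroup.mk f

/-- The positive cone `H^A_+`. -/
def CohPos (A : Matrix (Fin N) (Fin N) ℤ) : Set (Coh A) :=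
  {c | ∃ f : C(Space A, ℤ), (∀ x, 0 ≤ f x) ∧ c = cohClass A f}

/-- `u` is an order unit of `(H^A, H^A_+)`. -/
def IsOrderUnit (A : Matrix (Fin N) (Fin N) ℤ) (u : Coh A) : Prop :=
  u ∈ CohPos A ∧ ∀ g : Coh A, ∃ n : ℕ, 0 < n ∧ n • u - g ∈ CohPos A

/-- The data `(l, k, b)` of a suspension. -/
structure SuspData (A : Matrix (Fin N) (Fin N) ℤ) where
  l : C(Space A, ℝ)
  k : C(Space A, ℝ)
  b : C(Space A, ℝ)

/-- `c = l - k`. -/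
def cFun {A : Matrix (Fin N) (Fin N) ℤ} (T : SuspData A) (x : Space A) : ℝ :=
  T.l x - T.k x

/-- `(l, k, b)` is a suspension triplet for `(X_A, σ_A)`. -/
def IsSuspTriplet {A : Matrix (Fin N) (Fin N) ℤ} (T : SuspData A) : Prop :=
  (∀ x, 0 ≤ T.l x) ∧ (∀ x, 0 ≤ T.k x) ∧
  (∃ c : C(Space A, ℤ), (∀ x, (c x : ℝ) = cFun T x) ∧ IsOrderUnit A (cohClass A c)) ∧
  (∀ x, ∃ m : ℕ, T.l x - T.b x = m) ∧
  (∀ x, ∃ m : ℕ, T.k x - T.b (shift A x) = m)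

/-- The space `X_{A,b}^ℝ = {(x, r) : r ≥ b(x)}`. -/
abbrev BaseSpace {A : Matrix (Fin N) (Fin N) ℤ} (T : SuspData A) : Type :=
  {p : Space A × ℝ // T.b p.1 ≤ p.2}

/-- The elementary relation `(x, r) ∼ (σ_A(x), r - c(x))` for `r ≥ l(x)`. -/
def SuspRel {A : Matrix (Fin N) (Fin N) ℤ} (T : SuspData A)
    (p q : BaseSpace T) : Prop :=
  T.l p.1.1 ≤ p.1.2 ∧ q.1 = (shift A p.1.1, p.1.2 - cFun T p.1.1)

/-- The equivalence relation `∼_{l,k}` generated by `SuspRel`. -/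
def suspSetoid {A : Matrix (Fin N) (Fin N) ℤ} (T : SuspData A) : Setoid (BaseSpace T) :=
  ⟨Relation.EqvGen (SuspRel T), Relation.EqvGen.is_equivalence _⟩

/-- The one-sided suspension `S_{A,b}^{l,k}` with the quotient topology. -/
abbrev Susp {A : Matrix (Fin N) (Fin N) ℤ} (T : SuspData A) : Type :=
  Quotient (suspSetoid T)

/-- The class `[x, r]`. -/
def mkSusp {A : Matrix (Fin N) (Fin N) ℤ} (T : SuspData A) (p : BaseSpace T) : Susp T :=
  Quotient.mk (suspSetoid T) p

/-- The base map `x ↦ [x, b(x)]`. -/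
def basePoint {A : Matrix (Fin N) (Fin N) ℤ} (T : SuspData A) (x : Space A) : Susp T :=
  mkSusp T ⟨(x, T.b x), le_refl _⟩

/-- Translation by `t ≥ 0` on `X_{A,b}^ℝ`. -/
def shiftPt {A : Matrix (Fin N) (Fin N) ℤ} (T : SuspData A) (t : ℝ≥0)
    (p : BaseSpace T) : BaseSpace T :=
  ⟨(p.1.1, p.1.2 + t), le_trans p.2 (le_add_of_nonneg_right t.2)⟩

lemma suspRel_shiftPt {A : Matrix (Fin N) (Fin N) ℤ} (T : SuspData A) (t : ℝ≥0)
    {p q : BaseSpace T} (h : SuspRel T p q) : SuspRel T (shiftPt T t p) (shiftPt T t q) := by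
  obtain ⟨h1, h2⟩ := h
  refine ⟨le_trans h1 (le_add_of_nonneg_right t.2), ?_⟩
  show (q.1.1, q.1.2 + (t : ℝ)) = _
  rw [h2]
  show (shift A p.1.1, p.1.2 - cFun T p.1.1 + (t : ℝ))
      = (shift A p.1.1, p.1.2 + (t : ℝ) - cFun T p.1.1)
  congr 1
  ring

lemma eqvGen_map {α : Type*} {r r' : α → α → Prop} (f : α → α)
    (hf : ∀ a b, r a b → r' (f a) (f b)) :
    ∀ a b, Relation.EqvGen r a b → Relation.EqvGen r' (f a) (f b) := by
  intro a b h
  induction h with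
  | rel a b hab => exact Relation.EqvGen.rel _ _ (hf a b hab)
  | refl a => exact Relation.EqvGen.refl _
  | symm a b _ ih => exact Relation.EqvGen.symm _ _ ih
  | trans a b c _ _ ih1 ih2 => exact Relation.EqvGen.trans _ _ _ ih1 ih2

/-- The flow `φ_{A,t}([x, r]) = [x, r + t]`, `t ∈ ℝ_+`, on the one-sided suspension. -/
def flow {A : Matrix (Fin N) (Fin N) ℤ} (T : SuspData A) (t : ℝ≥0) :
    Susp T → Susp T :=
  Quotient.map' (shiftPt T t)
    (fun p q h => eqvGen_map (shiftPt T t) (fun _ _ hr => suspRel_shiftPt T t hr) p q h)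

/-- The standard suspension data `(1, 0, 0)`. -/
def stdData (A : Matrix (Fin N) (Fin N) ℤ) : SuspData A := ⟨1, 0, 0⟩

/-- The standard one-sided suspension `S_A^1`. -/
abbrev StdSusp (A : Matrix (Fin N) (Fin N) ℤ) : Type := Susp (stdData A)

/-- The standard base map `s_A(x) = [x, 0]`. -/
def stdBase (A : Matrix (Fin N) (Fin N) ℤ) : Space A → StdSusp A :=
  basePoint (stdData A)

/-- The orbit equations of a continuous orbit equivalence. -/
def OrbitEqFns (A : Matrix (Fin N) (Fin N) ℤ) (B : Matrix (Fin M) (Fin M) ℤ)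
    (h : Space A ≃ₜ Space B) (k1 l1 : C(Space A, ℕ)) (k2 l2 : C(Space B, ℕ)) : Prop :=
  (∀ x : Space A, (shift B)^[k1 x] (h (shift A x)) = (shift B)^[l1 x] (h x)) ∧
  (∀ y : Space B, (shift A)^[k2 y] (h.symm (shift B y)) = (shift A)^[l2 y] (h.symm y))

/-- `(X_A, σ_A)` and `(X_B, σ_B)` are continuously orbit equivalent. -/
def ContOrbitEquiv (A : Matrix (Fin N) (Fin N) ℤ) (B : Matrix (Fin M) (Fin M) ℤ) : Prop :=
  ∃ h : Space A ≃ₜ Space B, ∃ k1 l1 : C(Space A, ℕ), ∃ k2 l2 : C(Space B, ℕ),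
    OrbitEqFns A B h k1 l1 k2 l2

/-- One-sided flow equivalence via the homeomorphism `h`. -/
def FlowEquivVia (A : Matrix (Fin N) (Fin N) ℤ) (B : Matrix (Fin M) (Fin M) ℤ)
    (h : Space A ≃ₜ Space B) : Prop :=
  ∃ T₁ : SuspData A, IsSuspTriplet T₁ ∧ ∃ T₂ : SuspData B, IsSuspTriplet T₂ ∧
  ∃ Φ₁ : Susp T₁ → StdSusp B, Continuous Φ₁ ∧
  ∃ Φ₂ : Susp T₂ → StdSusp A, Continuous Φ₂ ∧
  (∀ (t : ℝ≥0) (p : Susp T₁), Φ₁ (flow T₁ t p) = flow (stdData B) t (Φ₁ p)) ∧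
  (∀ x : Space A, Φ₁ (basePoint T₁ x) = stdBase B (h x)) ∧
  (∀ (t : ℝ≥0) (q : Susp T₂), Φ₂ (flow T₂ t q) = flow (stdData A) t (Φ₂ q)) ∧
  (∀ y : Space B, Φ₂ (basePoint T₂ y) = stdBase A (h.symm y))

/-- `(X_A, σ_A)` and `(X_B, σ_B)` are one-sided flow equivalent. -/
def OneSidedFlowEquiv (A : Matrix (Fin N) (Fin N) ℤ) (B : Matrix (Fin M) (Fin M) ℤ) : Prop :=
  ∃ h : Space A ≃ₜ Space B, FlowEquivVia A B h

/-- `f^m(x) = Σ_{i<m} f(σ_A^i(x))` for integer-valued `f`. -/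
def birk (A : Matrix (Fin N) (Fin N) ℤ) (f : Space A → ℤ) (m : ℕ) (x : Space A) : ℤ :=
  ∑ i ∈ Finset.range m, f ((shift A)^[i] x)

/-- `f^m(x) = Σ_{i<m} f(σ_A^i(x))` for real-valued `f`. -/
def birkR (A : Matrix (Fin N) (Fin N) ℤ) (f : Space A → ℝ) (m : ℕ) (x : Space A) : ℝ :=
  ∑ i ∈ Finset.range m, f ((shift A)^[i] x)

/-- `f^m(x) = Σ_{i<m} f(σ_A^i(x))` for ℕ-valued `f`. -/
def birkN (A : Matrix (Fin N) (Fin N) ℤ) (f : Space A → ℕ) (m : ℕ) (x : Space A) : ℕ :=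
  ∑ i ∈ Finset.range m, f ((shift A)^[i] x)

/-- The map `Ψ_h` associated with a continuous orbit equivalence. -/
def psi (A : Matrix (Fin N) (Fin N) ℤ) (B : Matrix (Fin M) (Fin M) ℤ)
    (h : Space A → Space B) (l1 k1 : Space A → ℕ) (f : Space B → ℤ) :
    Space A → ℤ :=
  fun x => (∑ i ∈ Finset.range (l1 x), f ((shift B)^[i] (h x)))
    - ∑ j ∈ Finset.range (k1 x), f ((shift B)^[j] (h (shift A x)))

/-- The dynamical zeta function `ζ_{A,f}(s)` with potential `f`. -/
noncomputable def zeta (A : Matrix (Fin N) (Fin N) ℤ) (f : Space A → ℤ) (s : ℂ) : ℂ :=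
  Complex.exp (∑' n : ℕ, (1 / (n + 1 : ℂ)) *
    ∑' x : {x : Space A // (shift A)^[n + 1] x = x},
      Complex.exp (-s * ((birk A f (n + 1) x.1 : ℤ) : ℂ)))

/-- `γ` is a periodic orbit of `(X_A, σ_A)`. -/
def IsPerOrbit (A : Matrix (Fin N) (Fin N) ℤ) (γ : Set (Space A)) : Prop :=
  ∃ (x : Space A) (p : ℕ), 0 < p ∧ (shift A)^[p] x = x ∧
    (∀ q : ℕ, 0 < q → (shift A)^[q] x = x → p ≤ q) ∧
    γ = {y | ∃ i : ℕ, i < p ∧ y = (shift A)^[i] x}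

/-- `τ` is a primitive periodic orbit of the flow on the one-sided suspension. -/
def IsFlowOrbit {A : Matrix (Fin N) (Fin N) ℤ} (T : SuspData A) (τ : Set (Susp T)) : Prop :=
  ∃ u : Susp T, (∃ t : ℝ≥0, 0 < t ∧ flow T t u = u) ∧
    τ = Set.range (fun t : ℝ≥0 => flow T t u)

/-- `ℓ(u) = min { t > 0 : φ_{A,t}(u) = u }`. -/
noncomputable def pointLen {A : Matrix (Fin N) (Fin N) ℤ} (T : SuspData A) (u : Susp T) : ℝ≥0 :=
  sInf {t : ℝ≥0 | 0 < t ∧ flow T t u = u}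

/-- `ℓ(τ) = min { t > 0 : φ_{A,t}(u) = u for all u ∈ τ }`. -/
noncomputable def orbitLen {A : Matrix (Fin N) (Fin N) ℤ} (T : SuspData A)
    (τ : Set (Susp T)) : ℝ≥0 :=
  sInf {t : ℝ≥0 | 0 < t ∧ ∀ u ∈ τ, flow T t u = u}

section Paths

variable {A : Matrix (Fin N) (Fin N) ℤ}

lemma shift_iterate_apply (i : ℕ) (x : Space A) (t : ℕ) :
    ((shift A)^[i] x).1 t = x.1 (t + i) := by
  induction i generalizing x with
  | zero => rfl
  | succ i ih =>
    rw [Function.iterate_succ_apply, ih]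
    show x.1 (t + i + 1) = _
    rw [add_assoc]

/-- The path following `x` for `i` steps and `y` afterwards. -/
def concat (x : Space A) (i : ℕ) (y : Space A) (hxy : x.1 i = y.1 0) : Space A :=
  ⟨fun t => if t < i then x.1 t else y.1 (t - i), fun t => by
    rcases lt_trichotomy (t + 1) i with h | h | h
    · simp only [h, show t < i by omega, if_true]
      exact x.2 t
    · have h1 : x.1 (t + 1) = y.1 0 := by rw [h, hxy]
      simp only [show t < i by omega, show ¬ t + 1 < i by omega, if_true, if_false,
        show t + 1 - i = 0 by omega, ← h1]
      exact x.2 t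
    · simp only [show ¬ t < i by omega, show ¬ t + 1 < i by omega, if_false,
        show t + 1 - i = (t - i) + 1 by omega]
      exact y.2 (t - i)⟩

lemma concat_apply_of_lt {x y : Space A} {i : ℕ} (hxy : x.1 i = y.1 0) {t : ℕ} (ht : t < i) :
    (concat x i y hxy).1 t = x.1 t := if_pos ht

lemma concat_apply_add {x y : Space A} {i : ℕ} (hxy : x.1 i = y.1 0) (t : ℕ) :
    (concat x i y hxy).1 (t + i) = y.1 t := by
  simp [concat]

lemma shift_iterate_concat {x y : Space A} {i : ℕ} (hxy : x.1 i = y.1 0) :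
    (shift A)^[i] (concat x i y hxy) = y := by
  ext t : 2
  rw [shift_iterate_apply, concat_apply_add]

lemma concat_apply_of_agree {x y : Space A} {i K : ℕ} (hxy : x.1 i = y.1 0)
    (h : ∀ t < K, x.1 (t + i) = y.1 t) {t : ℕ} (ht : t < i + K) :
    (concat x i y hxy).1 t = x.1 t := by
  by_cases hti : t < i
  · exact concat_apply_of_lt hxy hti
  · obtain ⟨s, rfl⟩ : ∃ s, t = s + i := ⟨t - i, by omega⟩
    rw [concat_apply_add, h s (by omega)]

/-- A path whose initial window recurs at time `d` is shadowed by a point of period `d`. -/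
lemma exists_periodic_shadow {K d : ℕ} (hK : 0 < K) (hd : 0 < d) (z : Space A)
    (hz : ∀ t < K, z.1 (t + d) = z.1 t) :
    ∃ q : Space A, (shift A)^[d] q = q ∧ ∀ t < d + K, q.1 t = z.1 t := by
  refine ⟨⟨fun t => z.1 (t % d), fun t => ?_⟩, ?_, ?_⟩
  · have hlt := Nat.mod_lt t hd
    have hmod : (t + 1) % d = (t % d + 1) % d := by simp
    show A (z.1 (t % d)) (z.1 ((t + 1) % d)) = 1
    rw [hmod]
    by_cases h : t % d + 1 < d
    · rw [Nat.mod_eq_of_lt h]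
      exact z.2 _
    · have hd' : t % d + 1 = d := by omega
      have h0 := hz 0 hK
      rw [hd', Nat.mod_self, ← h0, zero_add]
      have := z.2 (t % d)
      rwa [hd'] at this
  · ext t : 2
    rw [shift_iterate_apply]
    simp
  · intro t
    induction t using Nat.strong_induction_on with
    | _ t ih =>
      intro ht
      by_cases h : t < d
      · simp [Nat.mod_eq_of_lt h]
      · have h1 := ih (t - d) (by omega) (by omega)
        have h2 := hz (t - d) (by omega)
        rw [Nat.sub_add_cancel (by omega)] at h2
        rw [h2, ← h1]
        simp [Nat.mod_eq_sub_mod (not_lt.mp h)]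

end Paths

section Topology

variable (A : Matrix (Fin N) (Fin N) ℤ)

instance compactSpace_space : CompactSpace (Space A) := by
  have hclosed : IsClosed {x : ℕ → Fin N | ∀ n, A (x n) (x (n + 1)) = 1} := by
    rw [Set.ofPred_forall]
    refine isClosed_iInter fun n => ?_
    have hc : Continuous fun x : ℕ → Fin N => (x n, x (n + 1)) := by fun_prop
    exact (isClosed_discrete {p : Fin N × Fin N | A p.1 p.2 = 1}).preimage hc
  exact isCompact_iff_compactSpace.mp hclosed.isCompact

variable {A}

lemma isOpen_cylinder (x : Space A) (n : ℕ) :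
    IsOpen {y : Space A | ∀ t < n, y.1 t = x.1 t} := by
  have : {y : Space A | ∀ t < n, y.1 t = x.1 t}
      = ⋂ t ∈ Set.Iio n, {y : Space A | y.1 t = x.1 t} := by
    ext; simp
  rw [this]
  refine (Set.finite_Iio n).isOpen_biInter fun t _ => ?_
  have hc : Continuous fun y : Space A => y.1 t :=
    (continuous_apply t).comp continuous_subtype_val
  exact (isOpen_discrete {x.1 t}).preimage hc

/-- Disjointness from the diagonal is witnessed by finitely many coordinates. -/
lemma exists_window (F : Set (Space A × Space A)) (hF : IsClosed F)
    (hdiag : ∀ x, (x, x) ∉ F) :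
    ∃ K, ∀ x y : Space A, (∀ t < K, x.1 t = y.1 t) → (x, y) ∉ F := by
  by_contra! hcon
  let S : ℕ → Set (Space A × Space A) := fun K => {p | ∀ t < K, p.1.1 t = p.2.1 t} ∩ F
  have hclosed : ∀ K, IsClosed (S K) := by
    intro K
    refine IsClosed.inter ?_ hF
    have : {p : Space A × Space A | ∀ t < K, p.1.1 t = p.2.1 t}
        = ⋂ t, ⋂ _ : t < K, {p : Space A × Space A | p.1.1 t = p.2.1 t} := by
      ext; simp
    rw [this]
    exact isClosed_iInter fun t => isClosed_iInter fun _ =>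
      isClosed_eq (((continuous_apply t).comp continuous_subtype_val).comp continuous_fst)
        (((continuous_apply t).comp continuous_subtype_val).comp continuous_snd)
  obtain ⟨p, hp⟩ := IsCompact.nonempty_iInter_of_sequence_nonempty_isCompact_isClosed S
    (fun K p hp => ⟨fun t ht => hp.1 t (by omega), hp.2⟩)
    (fun K => by
      obtain ⟨x, y, hxy, hmem⟩ := hcon K
      exact ⟨(x, y), hxy, hmem⟩)
    (hclosed 0).isCompact hclosed
  rw [Set.mem_iInter] at hp
  have heq : p.1 = p.2 := by
    ext t : 2
    exact (hp (t + 1)).1 t (by omega)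
  have := (hp 0).2
  rw [show p = (p.1, p.1) by rw [Prod.ext_iff]; exact ⟨rfl, heq.symm⟩] at this
  exact hdiag _ this

lemma exists_window_of_continuous {Y : Type*} [TopologicalSpace Y] [DiscreteTopology Y]
    (f : C(Space A, Y)) :
    ∃ K, ∀ x y : Space A, (∀ t < K, x.1 t = y.1 t) → f x = f y := by
  have hc : Continuous fun p : Space A × Space A => (f p.1, f p.2) := by fun_prop
  obtain ⟨K, hK⟩ := exists_window {p | f p.1 ≠ f p.2}
    ((isClosed_discrete {q : Y × Y | q.1 ≠ q.2}).preimage hc) (by simp)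
  exact ⟨K, fun x y h => by simpa using hK x y h⟩

lemma exists_cylinder_subset {x : Space A} {U : Set (Space A)} (hU : IsOpen U) (hx : x ∈ U) :
    ∃ n, ∀ y : Space A, (∀ t < n, y.1 t = x.1 t) → y ∈ U := by
  obtain ⟨K, hK⟩ := exists_window ({x} ×ˢ Uᶜ) (isClosed_singleton.prod hU.isClosed_compl)
    (fun y hy => hy.2 (by rw [show y = x from hy.1]; exact hx))
  refine ⟨K, fun y hy => ?_⟩
  have := hK x y fun t ht => (hy t ht).symm
  simpa using this

lemma continuous_of_window {Y : Type*} [TopologicalSpace Y] {f : Space A → Y} {K : ℕ}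
    (hf : ∀ x y : Space A, (∀ t < K, x.1 t = y.1 t) → f x = f y) : Continuous f := by
  refine IsLocallyConstant.continuous ((IsLocallyConstant.iff_exists_open f).2 fun x => ?_)
  exact ⟨_, isOpen_cylinder x K, fun _ _ => rfl, fun y hy => hf y x hy⟩

end Topology

section NoIsolatedPoints

variable {A : Matrix (Fin N) (Fin N) ℤ}

lemma IsIrreducible.exists_succ (h01 : IsZeroOne A) (hirr : IsIrreducible A) (i : Fin N) :
    ∃ j, A i j = 1 := by
  obtain ⟨m, hm, hne⟩ := hirr i i
  obtain ⟨k, rfl⟩ : ∃ k, m = k + 1 := ⟨m - 1, by omega⟩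
  rw [pow_succ', Matrix.mul_apply] at hne
  obtain ⟨j, -, hj⟩ := Finset.exists_ne_zero_of_sum_ne_zero hne
  exact ⟨j, (h01 i j).resolve_left (left_ne_zero_of_mul hj)⟩

/-- The shift space of an irreducible non-permutation matrix has no isolated points. -/
lemma exists_ne_of_agree (h01 : IsZeroOne A) (hirr : IsIrreducible A)
    (hnp : ¬ IsPermutationMatrix A) (y : Space A) (n : ℕ) :
    ∃ z : Space A, z ≠ y ∧ ∀ t < n, z.1 t = y.1 t := by
  by_contra! hcon
  have hiso : ∀ z : Space A, (∀ t < n, z.1 t = y.1 t) → z = y := by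
    intro z hz
    by_contra hne
    obtain ⟨t, ht, h⟩ := hcon z hne
    exact h (hz t ht)
  choose s hs using IsIrreducible.exists_succ h01 hirr
  have huniq : ∀ t, n ≤ t → ∀ j, A (y.1 t) j = 1 → j = y.1 (t + 1) := by
    intro t ht j hj
    let w : Space A := ⟨fun u => Nat.casesOn u (y.1 t) fun u => s^[u] j, fun u => by
      cases u with
      | zero => exact hj
      | succ u =>
        show A (s^[u] j) (s^[u + 1] j) = 1
        rw [Function.iterate_succ_apply']
        exact hs _⟩
    have hw : y.1 t = w.1 0 := rfl
    have heq := hiso (concat y t w hw) fun u hu => concat_apply_of_lt hw (by omega)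
    have h1 := concat_apply_add hw 1
    rw [heq, add_comm] at h1
    exact h1.symm
  have hreach : ∀ m v, (A ^ m) (y.1 n) v ≠ 0 → v = y.1 (n + m) := by
    intro m
    induction m with
    | zero =>
      intro v hv
      by_contra hne
      exact hv (by rw [pow_zero]; exact Matrix.one_apply_ne (Ne.symm hne))
    | succ m ih =>
      intro v hv
      rw [pow_succ, Matrix.mul_apply] at hv
      obtain ⟨w, -, hw⟩ := Finset.exists_ne_zero_of_sum_ne_zero hv
      have h1 := ih w (left_ne_zero_of_mul hw)
      have h2 := (h01 w v).resolve_left (right_ne_zero_of_mul hw)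
      exact huniq (n + m) (by omega) v (h1 ▸ h2)
  have hvert : ∀ v, ∃ m, v = y.1 (n + m + 1) := by
    intro v
    obtain ⟨m, hm, hne⟩ := hirr (y.1 n) v
    refine ⟨m - 1, ?_⟩
    rw [hreach m v hne, show n + (m - 1) + 1 = n + m by omega]
  have hsucc : ∀ v j, A v j = 1 → s v = j := by
    intro v j hj
    obtain ⟨m, rfl⟩ := hvert v
    rw [huniq _ (by omega) _ hj, huniq _ (by omega) _ (hs _)]
  have hsurj : Function.Surjective s := by
    intro v
    obtain ⟨m, rfl⟩ := hvert v
    exact ⟨y.1 (n + m), hsucc _ _ (y.2 _)⟩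
  refine hnp ⟨Equiv.ofBijective s ⟨Finite.injective_iff_surjective.2 hsurj, hsurj⟩, ?_⟩
  intro i j
  show A i j = if s i = j then 1 else 0
  split_ifs with h
  · rw [← h, hs]
  · exact (h01 i j).resolve_right fun h1 => h (hsucc i j h1)

end NoIsolatedPoints

section Cohomology

variable {A : Matrix (Fin N) (Fin N) ℤ}

lemma birk_add (f : Space A → ℤ) (m n : ℕ) (x : Space A) :
    birk A f (m + n) x = birk A f m x + birk A f n ((shift A)^[m] x) :=
  birkhoffSum_add (shift A) f m n x

lemma birk_congr {f : Space A → ℤ} {K : ℕ}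
    (hf : ∀ x y : Space A, (∀ t < K, x.1 t = y.1 t) → f x = f y) {m : ℕ} {x y : Space A}
    (hxy : ∀ t < m + K, x.1 t = y.1 t) : birk A f m x = birk A f m y := by
  refine Finset.sum_congr rfl fun i hi => hf _ _ fun t ht => ?_
  rw [Finset.mem_range] at hi
  rw [shift_iterate_apply, shift_iterate_apply]
  exact hxy _ (by omega)

/-- A long Birkhoff sum splits off the sum along a short periodic orbit. -/
lemma exists_birk_reduction {f : Space A → ℤ} {K : ℕ} (hK : 0 < K)
    (hf : ∀ x y : Space A, (∀ t < K, x.1 t = y.1 t) → f x = f y)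
    {m : ℕ} (hm : Fintype.card (Fin K → Fin N) ≤ m) (z : Space A) :
    ∃ d, 0 < d ∧ d ≤ Fintype.card (Fin K → Fin N) ∧ d ≤ m ∧ ∃ q : Space A,
      (shift A)^[d] q = q ∧ ∃ z' : Space A,
        birk A f m z = birk A f (m - d) z' + birk A f d q := by
  obtain ⟨a, a', hne, hwin⟩ := Fintype.exists_ne_map_eq_of_card_lt
    (fun (a : Fin (Fintype.card (Fin K → Fin N) + 1)) (t : Fin K) => z.1 (t + a)) (by simp)
  wlog hlt : a < a' generalizing a a'
  · exact this a' a hne.symm hwin.symm (lt_of_le_of_ne (not_lt.mp hlt) hne.symm)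
  obtain ⟨i, hi⟩ := a
  obtain ⟨j, hj⟩ := a'
  have hij : i < j := hlt
  have hw : ∀ t < K, z.1 (t + i) = z.1 (t + j) := fun t ht => congrFun hwin ⟨t, ht⟩
  obtain ⟨q, hq, hqz⟩ := exists_periodic_shadow (d := j - i) hK (by omega) ((shift A)^[i] z)
    (fun t ht => by
      rw [shift_iterate_apply, shift_iterate_apply, hw t ht,
        show t + (j - i) + i = t + j by omega])
  have h0 : z.1 i = ((shift A)^[j] z).1 0 := by
    rw [shift_iterate_apply]
    simpa using hw 0 hK
  refine ⟨j - i, by omega, by omega, by omega, q, hq, concat z i ((shift A)^[j] z) h0, ?_⟩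
  have e1 : birk A f m z = birk A f i z + (birk A f (j - i) ((shift A)^[i] z)
      + birk A f (m - j) ((shift A)^[j] z)) := by
    rw [show m = i + ((j - i) + (m - j)) by omega, birk_add, birk_add,
      ← Function.iterate_add_apply, show j - i + i = j by omega,
      show i + (j - i + (m - j)) - j = m - j by omega]
  have e2 : birk A f (m - (j - i)) (concat z i ((shift A)^[j] z) h0)
      = birk A f i z + birk A f (m - j) ((shift A)^[j] z) := by
    rw [show m - (j - i) = i + (m - j) by omega, birk_add, shift_iterate_concat]
    congr 1
    refine birk_congr hf fun t ht => concat_apply_of_agree (K := K) h0 (fun u hu => ?_) ht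
    rw [shift_iterate_apply]
    exact hw u hu
  rw [e1, e2, birk_congr hf hqz]
  ring

lemma birk_bddBelow (f : C(Space A, ℤ)) {K : ℕ} (hK : 0 < K)
    (hf : ∀ x y : Space A, (∀ t < K, x.1 t = y.1 t) → f x = f y)
    (hper : ∀ (q : Space A) (d : ℕ), 0 < d → d ≤ Fintype.card (Fin K → Fin N) →
      (shift A)^[d] q = q → 0 ≤ birk A f d q) :
    ∃ C : ℤ, ∀ m z, C ≤ birk A f m z := by
  obtain ⟨D, hD⟩ := (isCompact_range f.continuous).bddBelow
  have hD' : ∀ x, min D 0 ≤ f x := fun x => (min_le_left _ _).trans (hD ⟨x, rfl⟩)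
  refine ⟨(Fintype.card (Fin K → Fin N) : ℤ) * min D 0, fun m => ?_⟩
  induction m using Nat.strong_induction_on with
  | _ m ih =>
    intro z
    by_cases hm : Fintype.card (Fin K → Fin N) ≤ m
    · obtain ⟨d, hd, hdP, hdm, q, hq, z', hz'⟩ := exists_birk_reduction hK hf hm z
      have h1 := ih (m - d) (by omega) z'
      have h2 := hper q d hd hdP hq
      linarith
    · have h1 : (m : ℤ) * min D 0 ≤ birk A f m z := by
        have := Finset.card_nsmul_le_sum (Finset.range m)
          (fun i => f ((shift A)^[i] z)) (min D 0) (fun i _ => hD' _)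
        simpa [birk] using this
      refine le_trans ?_ h1
      exact mul_le_mul_of_nonpos_right (by exact_mod_cast (not_le.mp hm).le) (min_le_right _ _)

/-- Nonnegativity on short periodic orbits suffices for a nonnegative class. -/
lemma cohClass_mem_cohPos (f : C(Space A, ℤ)) {K : ℕ} (hK : 0 < K)
    (hf : ∀ x y : Space A, (∀ t < K, x.1 t = y.1 t) → f x = f y)
    (hper : ∀ (q : Space A) (d : ℕ), 0 < d → d ≤ Fintype.card (Fin K → Fin N) →
      (shift A)^[d] q = q → 0 ≤ birk A f d q) :
    cohClass A f ∈ CohPos A := by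
  obtain ⟨C, hC⟩ := birk_bddBelow f hK hf hper
  let S : Space A → Set ℤ := fun x => {a | ∃ m z, (shift A)^[m] z = x ∧ birk A f m z = a}
  have hbdd : ∀ x, BddBelow (S x) := by
    intro x
    refine ⟨C, ?_⟩
    rintro _ ⟨m, z, -, rfl⟩
    exact hC m z
  have hnon : ∀ x, (S x).Nonempty := fun x => ⟨_, 0, x, rfl, rfl⟩
  have hsub : ∀ x y : Space A, (∀ t < K, x.1 t = y.1 t) → S x ⊆ S y := by
    rintro x y hxy _ ⟨m, z, hz, rfl⟩
    have hz' : ∀ t, z.1 (t + m) = x.1 t := fun t => by rw [← hz, shift_iterate_apply]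
    have h0 : z.1 m = y.1 0 := by
      rw [← hxy 0 hK, ← hz' 0, zero_add]
    refine ⟨m, concat z m y h0, shift_iterate_concat h0, ?_⟩
    refine birk_congr hf fun t ht => concat_apply_of_agree (K := K) h0 (fun u hu => ?_) ht
    rw [hz', hxy u hu]
  have hgc : Continuous fun x => sInf (S x) := continuous_of_window (K := K) fun x y hxy =>
    congrArg sInf ((hsub x y hxy).antisymm (hsub y x fun t ht => (hxy t ht).symm))
  let g : C(Space A, ℤ) := ⟨fun x => sInf (S x), hgc⟩
  have hg : ∀ x, g (shift A x) ≤ g x + f x := by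
    intro x
    obtain ⟨m, z, hz, hgx⟩ := Int.csInf_mem (hnon x) (hbdd x)
    refine csInf_le (hbdd _) ⟨m + 1, z, ?_, ?_⟩
    · rw [Function.iterate_succ_apply', hz]
    · rw [birk_add, hz, hgx]
      simp [birk, g]
  refine ⟨f + (g - g.comp (shiftMap A)), fun x => ?_, ?_⟩
  · have := hg x
    show 0 ≤ f x + (g x - g (shift A x))
    linarith
  · refine QuotientAddGroup.eq.2 ?_
    rw [neg_add_cancel_left]
    exact AddSubgroup.subset_closure ⟨g, rfl⟩

/-- A function with positive sums along all periodic orbits represents an order unit. -/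
lemma isOrderUnit_of_birk_pos (c : C(Space A, ℤ))
    (hc : ∀ (q : Space A) (d : ℕ), 0 < d → (shift A)^[d] q = q → 0 < birk A c d q) :
    IsOrderUnit A (cohClass A c) := by
  obtain ⟨K₁, hK₁⟩ := exists_window_of_continuous c
  refine ⟨cohClass_mem_cohPos c K₁.succ_pos (fun x y h => hK₁ x y fun t ht => h t (by omega))
    fun q d hd _ hq => (hc q d hd hq).le, fun u => ?_⟩
  obtain ⟨g, rfl⟩ := QuotientAddGroup.mk_surjective u
  obtain ⟨K₂, hK₂⟩ := exists_window_of_continuous g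
  obtain ⟨D, hD⟩ := (isCompact_range g.continuous).bddAbove
  have hgD : ∀ x, g x ≤ D.toNat := fun x => (hD ⟨x, rfl⟩).trans (Int.self_le_toNat D)
  set K := K₁ + K₂ + 1 with hKdef
  set n : ℕ := Fintype.card (Fin K → Fin N) * D.toNat + 1 with hn
  refine ⟨n, by omega, ?_⟩
  show cohClass A (n • c - g) ∈ CohPos A
  have hval : ∀ x, (n • c - g) x = n * c x - g x := fun x => by simp
  refine cohClass_mem_cohPos (n • c - g) (K := K) (by omega) (fun x y h => ?_)
    fun q d hd hdP hq => ?_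
  · rw [hval, hval, hK₁ x y fun t ht => h t (by omega), hK₂ x y fun t ht => h t (by omega)]
  · have h1 : birk A (n • c - g : C(Space A, ℤ)) d q = n * birk A c d q - birk A g d q := by
      simp only [birk, hval, Finset.sum_sub_distrib, Finset.mul_sum]
    have h2 : birk A g d q ≤ d * D.toNat := by
      have := Finset.sum_le_card_nsmul (Finset.range d)
        (fun i => g ((shift A)^[i] q)) (D.toNat : ℤ) (fun i _ => hgD _)
      simpa [birk] using this
    have h3 : (d * D.toNat : ℤ) ≤ Fintype.card (Fin K → Fin N) * D.toNat := by
      exact_mod_cast Nat.mul_le_mul_right _ hdP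
    have h4 : (n : ℤ) ≤ n * birk A c d q :=
      le_mul_of_one_le_right (by positivity) (hc q d hd hq)
    rw [h1]
    have h5 : (n : ℤ) = Fintype.card (Fin K → Fin N) * D.toNat + 1 := by
      rw [hn]
      push_cast
      ring
    linarith

end Cohomology

section OrbitEquivalence

variable {A : Matrix (Fin N) (Fin N) ℤ} {B : Matrix (Fin M) (Fin M) ℤ}

lemma orbitEq_iterate {h : Space A → Space B} {k l : Space A → ℕ}
    (hkl : ∀ x, (shift B)^[k x] (h (shift A x)) = (shift B)^[l x] (h x)) (p : ℕ) (x : Space A) :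
    (shift B)^[birkN A k p x] (h ((shift A)^[p] x)) = (shift B)^[birkN A l p x] (h x) := by
  induction p with
  | zero => rfl
  | succ p ih =>
    have e : ∀ f : Space A → ℕ, birkN A f (p + 1) x = birkN A f p x + f ((shift A)^[p] x) :=
      fun f => Finset.sum_range_succ _ _
    rw [e, e, Function.iterate_succ_apply', Function.iterate_add_apply, hkl,
      ← Function.iterate_add_apply, add_comm, Function.iterate_add_apply, ih,
      ← Function.iterate_add_apply, add_comm]

lemma continuous_birkN (f : C(Space A, ℕ)) (p : ℕ) : Continuous (birkN A f p) :=
  continuous_finsetSum _ fun i _ => f.continuous.comp ((continuous_shift A).iterate i)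

/-- The cocycle of a continuous orbit equivalence is positive along periodic orbits: otherwise the
expanding return map at a periodic point would be conjugate to a non-expanding one. -/
lemma birkN_lt_of_periodic (h01 : IsZeroOne B) (hirr : IsIrreducible B)
    (hnp : ¬ IsPermutationMatrix B) (h : Space A ≃ₜ Space B) (k l : C(Space A, ℕ))
    (hkl : ∀ x, (shift B)^[k x] (h (shift A x)) = (shift B)^[l x] (h x))
    {x : Space A} {p : ℕ} (hp : 0 < p) (hx : (shift A)^[p] x = x) :
    birkN A k p x < birkN A l p x := by
  by_contra! hle
  set K := birkN A k p x with hK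
  set L := birkN A l p x with hL
  let W : Set (Space A) := {z | ∀ t < p, z.1 t = x.1 t} ∩ (birkN A k p ⁻¹' {K} ∩
    (birkN A l p ⁻¹' {L} ∩
      (fun z => h ((shift A)^[p] z)) ⁻¹' {w | ∀ t < K, w.1 t = (h x).1 t}))
  have hWo : IsOpen W := by
    refine (isOpen_cylinder x p).inter (((isOpen_discrete _).preimage (continuous_birkN k p)).inter
      (((isOpen_discrete _).preimage (continuous_birkN l p)).inter
        ((isOpen_cylinder (h x) K).preimage ?_)))
    exact h.continuous.comp ((continuous_shift A).iterate p)
  have hxW : x ∈ W := ⟨fun _ _ => rfl, rfl, rfl, fun t _ => congrArg (fun z => (h z).1 t) hx⟩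
  have htail : ∀ z ∈ W, ∀ t, (h ((shift A)^[p] z)).1 (t + K) = (h z).1 (t + L) := by
    rintro z ⟨-, hzK, hzL, -⟩ t
    have := orbitEq_iterate hkl p z
    rw [show birkN A k p z = K from hzK, show birkN A l p z = L from hzL] at this
    rw [← shift_iterate_apply, this, shift_iterate_apply]
  obtain ⟨n, hn⟩ := exists_cylinder_subset (x := h x) (hWo.preimage h.symm.continuous)
    (by simpa using hxW)
  have hcyl : ∀ z : Space A, (∀ t < n, (h z).1 t = (h x).1 t) → z ∈ W := fun z hz => by
    simpa using hn (h z) hz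
  have hinv : ∀ z : Space A, (∀ t < n, (h z).1 t = (h x).1 t) →
      ∀ t < n, (h ((shift A)^[p] z)).1 t = (h x).1 t := by
    intro z hz t ht
    have hzW := hcyl z hz
    by_cases htK : t < K
    · exact hzW.2.2.2 t htK
    · obtain ⟨s, rfl⟩ : ∃ s, t = s + K := ⟨t - K, by omega⟩
      have h1 := htail x hxW s
      rw [hx] at h1
      rw [htail z hzW, hz _ (by omega), h1]
  obtain ⟨y, hyne, hy⟩ := exists_ne_of_agree h01 hirr hnp (h x) n
  have hiter : ∀ m, ∀ t < n, (h (((shift A)^[p])^[m] (h.symm y))).1 t = (h x).1 t := by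
    intro m
    induction m with
    | zero => simpa using hy
    | succ m ih =>
      rw [Function.iterate_succ_apply']
      exact hinv _ ih
  apply hyne
  rw [← h.apply_symm_apply y]
  congr 1
  ext t : 2
  have hit : ∀ m z, (((shift A)^[p])^[m] z).1 (t % p) = z.1 (t % p + p * m) := by
    intro m z
    rw [← Function.iterate_mul, shift_iterate_apply]
  have hxm : ∀ m, ((shift A)^[p])^[m] x = x := fun m => Function.iterate_fixed hx m
  have h1 := (hcyl _ (hiter (t / p))).1 (t % p) (Nat.mod_lt t hp)
  have h2 := hit (t / p) x
  rw [hxm] at h2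
  rw [hit, h2, Nat.mod_add_div] at h1
  exact h1

/-- The suspension data `(l, k, 0)` of an orbit equivalence. -/
def orbitSusp (k l : C(Space A, ℕ)) : SuspData A :=
  ⟨⟨fun x => (l x : ℝ), by fun_prop⟩, ⟨fun x => (k x : ℝ), by fun_prop⟩, 0⟩

lemma isSuspTriplet_orbitSusp (h01 : IsZeroOne B) (hirr : IsIrreducible B)
    (hnp : ¬ IsPermutationMatrix B) (h : Space A ≃ₜ Space B) (k l : C(Space A, ℕ))
    (hkl : ∀ x, (shift B)^[k x] (h (shift A x)) = (shift B)^[l x] (h x)) :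
    IsSuspTriplet (orbitSusp k l) := by
  refine ⟨fun x => Nat.cast_nonneg _, fun x => Nat.cast_nonneg _,
    ⟨⟨fun x => (l x : ℤ) - k x, by fun_prop⟩, fun x => ?_, ?_⟩,
    fun x => ⟨l x, sub_zero _⟩, fun x => ⟨k x, sub_zero _⟩⟩
  · simp [cFun, orbitSusp]
  · refine isOrderUnit_of_birk_pos _ fun q d hd hq => ?_
    have := birkN_lt_of_periodic h01 hirr hnp h k l hkl hd hq
    simp only [birk, ContinuousMap.coe_mk, Finset.sum_sub_distrib, sub_pos]
    unfold birkN at this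
    exact_mod_cast this

lemma mkSusp_stdData_shift_iterate (y : Space B) (n : ℕ) (r : ℝ) (hr : (n : ℝ) ≤ r)
    (h0 : (stdData B).b y ≤ r) (h1 : (stdData B).b ((shift B)^[n] y) ≤ r - n) :
    mkSusp (stdData B) ⟨(y, r), h0⟩ = mkSusp (stdData B) ⟨((shift B)^[n] y, r - n), h1⟩ := by
  induction n with
  | zero => simp
  | succ n ih =>
    push_cast at hr
    have h2 : (stdData B).b ((shift B)^[n] y) ≤ r - n := by
      show (0 : ℝ) ≤ _
      linarith
    rw [ih (by linarith) h2]
    refine Quotient.sound (Relation.EqvGen.rel _ _ ⟨?_, ?_⟩)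
    · show (1 : ℝ) ≤ r - n
      linarith
    · rw [Function.iterate_succ_apply']
      simp only [cFun, stdData, ContinuousMap.one_apply, ContinuousMap.zero_apply, sub_zero,
        Nat.cast_add, Nat.cast_one, sub_sub]

lemma exists_suspMap (h : Space A ≃ₜ Space B) (k l : C(Space A, ℕ))
    (hkl : ∀ x, (shift B)^[k x] (h (shift A x)) = (shift B)^[l x] (h x)) :
    ∃ Φ : Susp (orbitSusp k l) → StdSusp B, Continuous Φ ∧
      (∀ (t : ℝ≥0) (p : Susp (orbitSusp k l)),
        Φ (flow (orbitSusp k l) t p) = flow (stdData B) t (Φ p)) ∧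
      ∀ x : Space A, Φ (basePoint (orbitSusp k l) x) = stdBase B (h x) := by
  let F : BaseSpace (orbitSusp k l) → BaseSpace (stdData B) :=
    fun p => ⟨(h p.1.1, p.1.2), p.2⟩
  have hF : ∀ p q, SuspRel (orbitSusp k l) p q →
      mkSusp (stdData B) (F p) = mkSusp (stdData B) (F q) := by
    rintro ⟨⟨x, r⟩, hr⟩ ⟨⟨y, s⟩, hs⟩ ⟨h1, h2⟩
    obtain ⟨rfl, rfl⟩ := Prod.mk.inj h2
    have h1' : (l x : ℝ) ≤ r := h1
    have e : r - cFun (orbitSusp k l) x = r - (l x - k x) := rfl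
    have hk : (k x : ℝ) ≤ r - cFun (orbitSusp k l) x := by rw [e]; linarith
    have hr1 : (stdData B).b ((shift B)^[l x] (h x)) ≤ r - l x := by
      show (0 : ℝ) ≤ _
      linarith
    have hs1 : (stdData B).b ((shift B)^[k x] (h (shift A x)))
        ≤ r - cFun (orbitSusp k l) x - k x := by
      show (0 : ℝ) ≤ _
      linarith
    refine (mkSusp_stdData_shift_iterate (h x) (l x) r h1' _ hr1).trans
      (Eq.trans ?_ (mkSusp_stdData_shift_iterate (h (shift A x)) (k x) _ hk _ hs1).symm)
    congr 1
    apply Subtype.ext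
    refine Prod.ext (hkl x).symm ?_
    simp only [e]
    ring
  have hgen : ∀ p q, Relation.EqvGen (SuspRel (orbitSusp k l)) p q →
      mkSusp (stdData B) (F p) = mkSusp (stdData B) (F q) := by
    intro p q hpq
    induction hpq with
    | rel p q hpq => exact hF p q hpq
    | refl p => rfl
    | symm p q _ ih => exact ih.symm
    | trans p q r _ _ ih1 ih2 => exact ih1.trans ih2
  refine ⟨Quotient.lift (fun p => mkSusp (stdData B) (F p)) hgen, ?_, ?_, fun x => rfl⟩
  · refine Continuous.quotient_lift (continuous_quotient_mk'.comp ?_) hgen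
    refine Continuous.subtype_mk ?_ _
    exact (h.continuous.comp (continuous_fst.comp continuous_subtype_val)).prodMk
      (continuous_snd.comp continuous_subtype_val)
  · rintro t ⟨p⟩
    rfl

end OrbitEquivalence

section FlowEquivalence

variable {A : Matrix (Fin N) (Fin N) ℤ} {B : Matrix (Fin M) (Fin M) ℤ}

/-- In the standard suspension, `[x, r]` determines `σ^⌊r⌋(x)`. -/
lemma shift_floor_eq_of_mkSusp_eq {p q : BaseSpace (stdData B)}
    (hpq : mkSusp (stdData B) p = mkSusp (stdData B) q) :
    (shift B)^[⌊p.1.2⌋₊] p.1.1 = (shift B)^[⌊q.1.2⌋₊] q.1.1 := by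
  have hgen : Relation.EqvGen (SuspRel (stdData B)) p q := Quotient.exact hpq
  clear hpq
  induction hgen with
  | rel p q hpq =>
    obtain ⟨⟨x, r⟩, hr⟩ := p
    obtain ⟨⟨y, s⟩, hs⟩ := q
    obtain ⟨h1, h2⟩ := hpq
    obtain ⟨rfl, rfl⟩ := Prod.mk.inj h2
    have h1' : (1 : ℝ) ≤ r := h1
    have e : r - cFun (stdData B) x = r - 1 := by simp [cFun, stdData]
    have hfl : 1 ≤ ⌊r⌋₊ := Nat.le_floor (by exact_mod_cast h1')
    simp only [e, Nat.floor_sub_one, ← Function.iterate_succ_apply]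
    congr 2
    omega
  | refl p => rfl
  | symm p q _ ih => exact ih.symm
  | trans p q r _ _ ih1 ih2 => exact ih1.trans ih2

lemma exists_continuous_nat {f : Space A → ℝ} (hf : Continuous f)
    (hn : ∀ x, ∃ m : ℕ, f x = m) : ∃ g : C(Space A, ℕ), ∀ x, f x = g x := by
  choose g hg using hn
  refine ⟨⟨g, ?_⟩, hg⟩
  rw [Nat.isClosedEmbedding_coe_real.isEmbedding.continuous_iff]
  exact hf.congr hg

/-- A flow map into the standard suspension that covers `h` yields an orbit equation for `h`. -/
lemma exists_orbitEq_of_suspMap (T : SuspData A) (hT : IsSuspTriplet T) (h : Space A → Space B)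
    (Φ : Susp T → StdSusp B)
    (hflow : ∀ (t : ℝ≥0) (p : Susp T), Φ (flow T t p) = flow (stdData B) t (Φ p))
    (hbase : ∀ x : Space A, Φ (basePoint T x) = stdBase B (h x)) :
    ∃ k l : C(Space A, ℕ),
      ∀ x, (shift B)^[k x] (h (shift A x)) = (shift B)^[l x] (h x) := by
  obtain ⟨-, -, -, hl, hk⟩ := hT
  obtain ⟨l, hl⟩ := exists_continuous_nat (by fun_prop) hl
  obtain ⟨k, hk⟩ := exists_continuous_nat (f := fun x => T.k x - T.b (shift A x))
    (T.k.continuous.sub (T.b.continuous.comp (continuous_shift A))) hk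
  refine ⟨k, l, fun x => ?_⟩
  have hrel : flow T (k x) (basePoint T (shift A x)) = flow T (l x) (basePoint T x) := by
    refine Eq.symm (Quotient.sound (Relation.EqvGen.rel _ _ ⟨?_, ?_⟩))
    · show T.l x ≤ T.b x + ((l x : ℝ≥0) : ℝ)
      rw [NNReal.coe_natCast, ← hl x]
      linarith
    · show (shift A x, T.b (shift A x) + ((k x : ℝ≥0) : ℝ))
        = (shift A x, T.b x + ((l x : ℝ≥0) : ℝ) - (T.l x - T.k x))
      rw [NNReal.coe_natCast, NNReal.coe_natCast, ← hl x, ← hk x]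
      congr 1
      ring
  have := congrArg Φ hrel
  rw [hflow, hflow, hbase, hbase] at this
  have := shift_floor_eq_of_mkSusp_eq (p := shiftPt (stdData B) (k x) ⟨(h (shift A x), 0), le_rfl⟩)
    (q := shiftPt (stdData B) (l x) ⟨(h x, 0), le_rfl⟩) this
  simpa [shiftPt] using this

end FlowEquivalence

theorem oneSidedFlowEquiv_iff_contOrbitEquiv
    {N M : ℕ} (A : Matrix (Fin N) (Fin N) ℤ) (B : Matrix (Fin M) (Fin M) ℤ)
    (hN : 1 < N) (hM : 1 < M) (hA01 : IsZeroOne A) (hB01 : IsZeroOne B)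
    (hAirr : IsIrreducible A) (hBirr : IsIrreducible B)
    (hAnp : ¬ IsPermutationMatrix A) (hBnp : ¬ IsPermutationMatrix B) :
    OneSidedFlowEquiv A B ↔ ContOrbitEquiv A B := by
  constructor
  · rintro ⟨h, T₁, hT₁, T₂, hT₂, Φ₁, -, Φ₂, -, hflow₁, hbase₁, hflow₂, hbase₂⟩
    obtain ⟨k₁, l₁, h₁⟩ := exists_orbitEq_of_suspMap T₁ hT₁ h Φ₁ hflow₁ hbase₁
    obtain ⟨k₂, l₂, h₂⟩ := exists_orbitEq_of_suspMap T₂ hT₂ h.symm Φ₂ hflow₂ hbase₂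
    exact ⟨h, k₁, l₁, k₂, l₂, h₁, h₂⟩
  · rintro ⟨h, k₁, l₁, k₂, l₂, h₁, h₂⟩
    obtain ⟨Φ₁, hc₁, hflow₁, hbase₁⟩ := exists_suspMap h k₁ l₁ h₁
    obtain ⟨Φ₂, hc₂, hflow₂, hbase₂⟩ := exists_suspMap h.symm k₂ l₂ h₂
    exact ⟨h, orbitSusp k₁ l₁, isSuspTriplet_orbitSusp hB01 hBirr hBnp h k₁ l₁ h₁,
      orbitSusp k₂ l₂, isSuspTriplet_orbitSusp hA01 hAirr hAnp h.symm k₂ l₂ h₂,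
      Φ₁, hc₁, Φ₂, hc₂, hflow₁, hbase₁, hflow₂, hbase₂⟩

end OneSidedMarkov
end

section
/- If one-sided topological Markov shifts (X_A, σ_A) and (X_B, σ_B) are one-sided flow equivalent, then they are continuously orbit equivalent. -/
open scoped BigOperators NNReal

namespace OneSidedMarkov

variable {N M : ℕ}

/-- The point `σ_A^⌊r⌋(x)`, an invariant of the class `[x, r]` in the standard suspension. -/
noncomputable def floorShift (A : Matrix (Fin N) (Fin N) ℤ) (p : BaseSpace (stdData A)) :
    Space A :=
  (shift A)^[⌊p.1.2⌋₊] p.1.1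

lemma floorShift_eq_of_suspRel (A : Matrix (Fin N) (Fin N) ℤ) {p q : BaseSpace (stdData A)}
    (hpq : SuspRel (stdData A) p q) : floorShift A p = floorShift A q := by
  obtain ⟨⟨x, r⟩, hp⟩ := p
  obtain ⟨q, hq⟩ := q
  obtain ⟨h1, rfl⟩ := hpq
  have hr : (1 : ℝ) ≤ r := h1
  have hc : cFun (stdData A) x = 1 := by simp [cFun, stdData]
  have hfloor : ⌊r⌋₊ = ⌊r - 1⌋₊ + 1 := by
    rw [← Nat.floor_add_one (sub_nonneg.2 hr), sub_add_cancel]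
  simp only [floorShift, hc]
  rw [hfloor, Function.iterate_succ_apply]

lemma floorShift_eq_of_mkSusp_eq (A : Matrix (Fin N) (Fin N) ℤ) {p q : BaseSpace (stdData A)}
    (hpq : mkSusp (stdData A) p = mkSusp (stdData A) q) : floorShift A p = floorShift A q := by
  have h : Relation.EqvGen (SuspRel (stdData A)) p q := Quotient.exact hpq
  induction h with
  | rel _ _ h => exact floorShift_eq_of_suspRel A h
  | refl => rfl
  | symm _ _ h ih => exact (ih (Quotient.sound h)).symm
  | trans _ _ _ h h' ih ih' => exact (ih (Quotient.sound h)).trans (ih' (Quotient.sound h'))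

lemma iterate_shift_eq_of_flow_stdBase_eq (A : Matrix (Fin N) (Fin N) ℤ) {m n : ℕ}
    {x y : Space A}
    (hxy : flow (stdData A) (m : ℝ≥0) (stdBase A x) = flow (stdData A) (n : ℝ≥0) (stdBase A y)) :
    (shift A)^[m] x = (shift A)^[n] y := by
  simpa [floorShift, shiftPt, stdData] using
    floorShift_eq_of_mkSusp_eq A (p := shiftPt (stdData A) m ⟨(x, (stdData A).b x), le_rfl⟩)
      (q := shiftPt (stdData A) n ⟨(y, (stdData A).b y), le_rfl⟩) hxy

lemma flow_basePoint_shift {A : Matrix (Fin N) (Fin N) ℤ} (T : SuspData A) (x : Space A)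
    {m n : ℕ} (hm : T.l x - T.b x = m) (hn : T.k x - T.b (shift A x) = n) :
    flow T (m : ℝ≥0) (basePoint T x) = flow T (n : ℝ≥0) (basePoint T (shift A x)) := by
  refine Quotient.sound (Relation.EqvGen.rel _ _ ⟨?_, ?_⟩)
  · simp only [shiftPt, NNReal.coe_natCast]
    linarith
  · simp only [shiftPt, NNReal.coe_natCast, Prod.mk.injEq, true_and, cFun]
    linarith

/-- A real-valued continuous function with values in `ℕ` is continuous as an `ℕ`-valued map. -/
lemma exists_continuousMap_nat {X : Type*} [TopologicalSpace X] {f : X → ℝ}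
    (hf : Continuous f) (hnat : ∀ x, ∃ m : ℕ, f x = m) : ∃ g : C(X, ℕ), ∀ x, f x = g x := by
  choose g hg using hnat
  refine ⟨⟨g, Nat.isClosedEmbedding_coe_real.isInducing.continuous_iff.2 ?_⟩, hg⟩
  exact hf.congr hg

/-- A flow-equivariant map into the standard suspension that restricts to `h` on the bases
forces `h` to satisfy an orbit equation. -/
lemma exists_orbit_equation {A : Matrix (Fin N) (Fin N) ℤ} {B : Matrix (Fin M) (Fin M) ℤ}
    {T : SuspData A} (hT : IsSuspTriplet T) (h : Space A → Space B) (Φ : Susp T → StdSusp B)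
    (hflow : ∀ (t : ℝ≥0) (p : Susp T), Φ (flow T t p) = flow (stdData B) t (Φ p))
    (hbase : ∀ x, Φ (basePoint T x) = stdBase B (h x)) :
    ∃ k l : C(Space A, ℕ), ∀ x, (shift B)^[k x] (h (shift A x)) = (shift B)^[l x] (h x) := by
  obtain ⟨-, -, -, hl, hk⟩ := hT
  obtain ⟨l, hl⟩ := exists_continuousMap_nat (T.l.continuous.sub T.b.continuous) hl
  obtain ⟨k, hk⟩ := exists_continuousMap_nat
    (T.k.continuous.sub (T.b.continuous.comp (continuous_shift A))) hk
  refine ⟨k, l, fun x => iterate_shift_eq_of_flow_stdBase_eq B ?_⟩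
  rw [← hbase, ← hbase, ← hflow, ← hflow, flow_basePoint_shift T x (hl x) (hk x)]

theorem oneSidedFlowEquiv_implies_contOrbitEquiv
    {N M : ℕ} (A : Matrix (Fin N) (Fin N) ℤ) (B : Matrix (Fin M) (Fin M) ℤ)
    (hN : 1 < N) (hM : 1 < M) (hA01 : IsZeroOne A) (hB01 : IsZeroOne B)
    (hAirr : IsIrreducible A) (hBirr : IsIrreducible B)
    (hAnp : ¬ IsPermutationMatrix A) (hBnp : ¬ IsPermutationMatrix B)
    (hfe : OneSidedFlowEquiv A B) :
    ContOrbitEquiv A B := by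
  obtain ⟨h, T₁, hT₁, T₂, hT₂, Φ₁, -, Φ₂, -, hflow₁, hbase₁, hflow₂, hbase₂⟩ := hfe
  obtain ⟨k₁, l₁, h₁⟩ := exists_orbit_equation hT₁ h Φ₁ hflow₁ hbase₁
  obtain ⟨k₂, l₂, h₂⟩ := exists_orbit_equation hT₂ h.symm Φ₂ hflow₂ hbase₂
  exact ⟨h, k₁, l₁, k₂, l₂, h₁, h₂⟩

end OneSidedMarkov
end

section
/- Let (l, k, b) be a suspension triplet for (X_A, σ_A) and c = l − k. For (x, r), (x', r') ∈ X_{A,b}^ℝ, one has (x, r) ∼_{l,k} (x', r') if and only if there exist n, n' ∈ ℤ_{≥0} such that σ_A^n(x) = σ_A^{n'}(x'), r − c^n(x) = r' − c^{n'}(x'), and moreover r − c^m(x) ≥ l(σ_A^m(x)) for all 0 ≤ m < n and r' − c^{m'}(x') ≥ l(σ_A^{m'}(x')) for all 0 ≤ m' < n'. -/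
open scoped BigOperators NNReal

namespace OneSidedMarkov

variable {N M : ℕ}

lemma birkR_succ (A : Matrix (Fin N) (Fin N) ℤ) (f : Space A → ℝ) (m : ℕ) (x : Space A) :
    birkR A f (m + 1) x = birkR A f m x + f ((shift A)^[m] x) :=
  Finset.sum_range_succ _ _

lemma IsSuspTriplet.b_shift_le {A : Matrix (Fin N) (Fin N) ℤ} {T : SuspData A}
    (hT : IsSuspTriplet T) {x : Space A} {r : ℝ} (h : T.l x ≤ r) :
    T.b (shift A x) ≤ r - cFun T x := by
  obtain ⟨m, hm⟩ := hT.2.2.2.2 x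
  have : (0 : ℝ) ≤ m := m.cast_nonneg
  unfold cFun
  linarith

lemma SuspRel.right_unique {A : Matrix (Fin N) (Fin N) ℤ} {T : SuspData A}
    {p q q' : BaseSpace T} (h : SuspRel T p q) (h' : SuspRel T p q') : q = q' :=
  Subtype.ext (h.2.trans h'.2.symm)

lemma eqvGen_suspRel_iff_join {A : Matrix (Fin N) (Fin N) ℤ} {T : SuspData A}
    {p q : BaseSpace T} :
    Relation.EqvGen (SuspRel T) p q ↔
      Relation.Join (Relation.ReflTransGen (SuspRel T)) p q := by
  have hJ : Equivalence (Relation.Join (Relation.ReflTransGen (SuspRel T))) :=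
    Relation.equivalence_join_reflTransGen fun a b c hab hac =>
      ⟨b, .refl, hab.right_unique hac ▸ .refl⟩
  constructor
  · intro h
    exact hJ.eqvGen_iff.mp (Relation.EqvGen.eqvGen_mono
      (fun a b hab => ⟨b, .single hab, .refl⟩) _ _ h)
  · rintro ⟨c, hpc, hqc⟩
    exact .trans _ _ _ (Relation.EqvGen.reflTransGen_le_eqvGen _ _ _ hpc)
      (.symm _ _ (Relation.EqvGen.reflTransGen_le_eqvGen _ _ _ hqc))

lemma exists_iterate_of_reflTransGen {A : Matrix (Fin N) (Fin N) ℤ} {T : SuspData A}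
    {p q : BaseSpace T} (h : Relation.ReflTransGen (SuspRel T) p q) :
    ∃ n : ℕ, q.1 = ((shift A)^[n] p.1.1, p.1.2 - birkR A (cFun T) n p.1.1) ∧
      ∀ m < n, T.l ((shift A)^[m] p.1.1) ≤ p.1.2 - birkR A (cFun T) m p.1.1 := by
  induction h with
  | refl => exact ⟨0, by simp [birkR], by simp⟩
  | tail _ hqs ih =>
    obtain ⟨n, hq, hn⟩ := ih
    obtain ⟨hl, hs⟩ := hqs
    rw [hq] at hl hs
    refine ⟨n + 1, ?_, fun m hm => ?_⟩
    · rw [hs, birkR_succ, Function.iterate_succ_apply', sub_sub]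
    · rcases Nat.lt_succ_iff_lt_or_eq.mp hm with hm | rfl
      exacts [hn m hm, hl]

lemma IsSuspTriplet.exists_reflTransGen {A : Matrix (Fin N) (Fin N) ℤ} {T : SuspData A}
    (hT : IsSuspTriplet T) (p : BaseSpace T) (n : ℕ)
    (hn : ∀ m < n, T.l ((shift A)^[m] p.1.1) ≤ p.1.2 - birkR A (cFun T) m p.1.1) :
    ∃ q : BaseSpace T, Relation.ReflTransGen (SuspRel T) p q ∧
      q.1 = ((shift A)^[n] p.1.1, p.1.2 - birkR A (cFun T) n p.1.1) := by
  induction n with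
  | zero => exact ⟨p, .refl, by simp [birkR]⟩
  | succ n ih =>
    obtain ⟨q, hpq, hq⟩ := ih fun m hm => hn m (hm.trans n.lt_succ_self)
    have hl : T.l q.1.1 ≤ q.1.2 := by
      rw [hq]
      exact hn n n.lt_succ_self
    refine ⟨⟨(shift A q.1.1, q.1.2 - cFun T q.1.1), hT.b_shift_le hl⟩,
      hpq.tail ⟨hl, rfl⟩, ?_⟩
    simp only [hq]
    rw [birkR_succ, Function.iterate_succ_apply', sub_sub]

theorem suspRel_iff_exists
    {N : ℕ} (A : Matrix (Fin N) (Fin N) ℤ)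
    (hN : 1 < N) (hA01 : IsZeroOne A)
    (hAirr : IsIrreducible A) (hAnp : ¬ IsPermutationMatrix A)
    (T : SuspData A) (hT : IsSuspTriplet T)
    (x x' : Space A) (r r' : ℝ) (hr : T.b x ≤ r) (hr' : T.b x' ≤ r') :
    Relation.EqvGen (SuspRel T) ⟨(x, r), hr⟩ ⟨(x', r'), hr'⟩ ↔
      ∃ n n' : ℕ,
        (shift A)^[n] x = (shift A)^[n'] x' ∧
        r - birkR A (cFun T) n x = r' - birkR A (cFun T) n' x' ∧
        (∀ m : ℕ, m < n → T.l ((shift A)^[m] x) ≤ r - birkR A (cFun T) m x) ∧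
        (∀ m' : ℕ, m' < n' → T.l ((shift A)^[m'] x') ≤ r' - birkR A (cFun T) m' x') := by
  rw [eqvGen_suspRel_iff_join]
  constructor
  · rintro ⟨q, hp, hp'⟩
    obtain ⟨n, hq, hn⟩ := exists_iterate_of_reflTransGen hp
    obtain ⟨n', hq', hn'⟩ := exists_iterate_of_reflTransGen hp'
    have h := Prod.mk.inj (hq.symm.trans hq')
    exact ⟨n, n', h.1, h.2, hn, hn'⟩
  · rintro ⟨n, n', hx, hc, hn, hn'⟩
    obtain ⟨q, hp, hq⟩ := hT.exists_reflTransGen ⟨(x, r), hr⟩ n hn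
    obtain ⟨q', hp', hq'⟩ := hT.exists_reflTransGen ⟨(x', r'), hr'⟩ n' hn'
    have h : q = q' := Subtype.ext (hq.trans ((Prod.ext hx hc).trans hq'.symm))
    exact ⟨q, hp, h ▸ hp'⟩

end OneSidedMarkov
end

section
/- Let c ∈ C(X_A, ℤ) be such that its class [c] ∈ H^A_+ is an order unit of (H^A, H^A_+). Then for any m ∈ ℕ there exists n_m ∈ ℕ such that c^{n_m}(x) ≥ m for all x ∈ X_A. -/
open scoped BigOperators NNReal

namespace OneSidedMarkov

variable {N M : ℕ}

/-- `X_A` is compact, being closed in the full shift. -/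
lemma compactSpace_space_s5 (A : Matrix (Fin N) (Fin N) ℤ) : CompactSpace (Space A) := by
  have hclosed : IsClosed {x : ℕ → Fin N | ∀ n, A (x n) (x (n + 1)) = 1} := by
    rw [Set.ofPred_forall]
    refine isClosed_iInter fun n => ?_
    have hcont : Continuous fun x : ℕ → Fin N => (x n, x (n + 1)) :=
      (continuous_apply n).prodMk (continuous_apply (n + 1))
    exact (isClosed_discrete {p : Fin N × Fin N | A p.1 p.2 = 1}).preimage hcont
  exact isCompact_iff_compactSpace.mp hclosed.isCompact

/-- Every element of the coboundary subgroup is itself of the form `g - g ∘ σ_A`. -/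
lemma exists_eq_of_mem_cobdySubgroup {A : Matrix (Fin N) (Fin N) ℤ} {f : C(Space A, ℤ)}
    (hf : f ∈ cobdySubgroup A) :
    ∃ g : C(Space A, ℤ), ∀ x, f x = g x - g (shift A x) := by
  induction hf using AddSubgroup.closure_induction with
  | mem f hf =>
    obtain ⟨g, rfl⟩ := hf
    exact ⟨g, fun _ => rfl⟩
  | zero => exact ⟨0, fun _ => by simp⟩
  | add f₁ f₂ _ _ h₁ h₂ =>
    obtain ⟨g₁, h₁⟩ := h₁
    obtain ⟨g₂, h₂⟩ := h₂
    refine ⟨g₁ + g₂, fun x => ?_⟩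
    simp only [ContinuousMap.add_apply, h₁, h₂]
    ring
  | neg f _ h =>
    obtain ⟨g, h⟩ := h
    refine ⟨-g, fun x => ?_⟩
    simp only [ContinuousMap.neg_apply, h]
    ring

/-- Birkhoff sums of a coboundary telescope. -/
lemma birk_coboundary (A : Matrix (Fin N) (Fin N) ℤ) (g : Space A → ℤ) (k : ℕ) (x : Space A) :
    birk A (fun y => g y - g (shift A y)) k x = g x - g ((shift A)^[k] x) := by
  simp only [birk, ← Function.iterate_succ_apply']
  exact Finset.sum_range_sub' (fun i => g ((shift A)^[i] x)) k

/-- Some multiple of a representative of an order unit is at least `1` up to a coboundary. -/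
lemma IsOrderUnit.exists_one_add_coboundary_le {A : Matrix (Fin N) (Fin N) ℤ}
    {c : C(Space A, ℤ)} (hc : IsOrderUnit A (cohClass A c)) :
    ∃ n : ℕ, 0 < n ∧ ∃ g : C(Space A, ℤ), ∀ x, 1 + (g x - g (shift A x)) ≤ n * c x := by
  obtain ⟨n, hn, f, hf, hnf⟩ := hc.2 (cohClass A 1)
  have hmem : -f + (n • c - 1) ∈ cobdySubgroup A := QuotientAddGroup.eq.mp hnf.symm
  obtain ⟨g, hg⟩ := exists_eq_of_mem_cobdySubgroup hmem
  refine ⟨n, hn, g, fun x => ?_⟩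
  have hx := hg x
  simp only [ContinuousMap.add_apply, ContinuousMap.neg_apply, ContinuousMap.sub_apply,
    ContinuousMap.one_apply, ContinuousMap.smul_apply] at hx
  rw [nsmul_eq_mul] at hx
  linarith [hf x]

theorem orderUnit_birkhoff_unbounded
    {N : ℕ} (A : Matrix (Fin N) (Fin N) ℤ)
    (hN : 1 < N) (hA01 : IsZeroOne A)
    (hAirr : IsIrreducible A) (hAnp : ¬ IsPermutationMatrix A)
    (c : C(Space A, ℤ)) (hc : IsOrderUnit A (cohClass A c)) :
    ∀ m : ℕ, 0 < m → ∃ n : ℕ, 0 < n ∧ ∀ x : Space A, (m : ℤ) ≤ birk A (⇑c) n x := by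
  intro m _
  obtain ⟨n, hn, g, hg⟩ := hc.exists_one_add_coboundary_le
  have := compactSpace_space_s5 A
  obtain ⟨a, ha⟩ := (isCompact_range g.continuous).bddAbove
  obtain ⟨b, hb⟩ := (isCompact_range g.continuous).bddBelow
  have hsum : ∀ (k : ℕ) (x : Space A), k + (b - a) ≤ n * birk A c k x := by
    intro k x
    have hle : k + birk A (fun y => g y - g (shift A y)) k x ≤ n * birk A c k x := by
      simpa [birk, Finset.mul_sum, Finset.sum_add_distrib] using
        Finset.sum_le_sum fun i (_ : i ∈ Finset.range k) => hg ((shift A)^[i] x)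
    rw [birk_coboundary] at hle
    linarith [hb (Set.mem_range_self x), ha (Set.mem_range_self ((shift A)^[k] x))]
  refine ⟨n * m + (a - b).toNat + 1, Nat.succ_pos _, fun x => ?_⟩
  have hx := hsum (n * m + (a - b).toNat + 1) x
  push_cast at hx
  refine le_of_mul_le_mul_left ?_ (Int.natCast_pos.mpr hn)
  linarith [Int.self_le_toNat (a - b)]

end OneSidedMarkov
end
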